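/- arXiv:2304.07187 — 3 statements merged into one kernel-verified Lean document; each statement's English description precedes it below -/
import Mathlib

section
/- In a finite two-player normal-form game (not necessarily zero-sum), if μ is an ε-coarse correlated equilibrium, then for each player i the utility of the marginal strategy profile exceeds the expected utility under μ by at most ε; that is, u_i(s^μ) − E_{ρ∼μ}[u_i(ρ)] ≤ ε. -/
open Finset

/-- A probability distribution on a finite type, represented as a nonnegative
real-valued function summing to one. -/
def IsDist {α : Type*} [Fintype α] (p : α → ℝ) : Prop :=
  (∀ x, 0 ≤ p x) ∧ ∑ x, p x = 1

/-- The marginal of a joint distribution `μ` on the first player's pure strategies. -/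
def marg1 {P₁ P₂ : Type*} [Fintype P₁] [Fintype P₂] (μ : P₁ × P₂ → ℝ) : P₁ → ℝ :=
  fun a => ∑ b, μ (a, b)

/-- The marginal of a joint distribution `μ` on the second player's pure strategies. -/
def marg2 {P₁ P₂ : Type*} [Fintype P₁] [Fintype P₂] (μ : P₁ × P₂ → ℝ) : P₂ → ℝ :=
  fun b => ∑ a, μ (a, b)

/-- Expected utility when the players independently play mixed strategies `s₁` and `s₂`. -/
def mixedU {P₁ P₂ : Type*} [Fintype P₁] [Fintype P₂]
    (u : P₁ × P₂ → ℝ) (s₁ : P₁ → ℝ) (s₂ : P₂ → ℝ) : ℝ :=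
  ∑ a, ∑ b, s₁ a * s₂ b * u (a, b)

/-- Expected utility when player 1 plays mixed strategy `s₁` and player 2 plays
the pure strategy `b`. -/
def mixedU1 {P₁ P₂ : Type*} [Fintype P₁] [Fintype P₂]
    (u : P₁ × P₂ → ℝ) (s₁ : P₁ → ℝ) (b : P₂) : ℝ :=
  ∑ a, s₁ a * u (a, b)

/-- Expected utility when player 1 plays the pure strategy `a` and player 2 plays
mixed strategy `s₂`. -/
def mixedU2 {P₁ P₂ : Type*} [Fintype P₁] [Fintype P₂]
    (u : P₁ × P₂ → ℝ) (a : P₁) (s₂ : P₂ → ℝ) : ℝ :=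
  ∑ b, s₂ b * u (a, b)

/-- Expectation of `f(ρ)` for `ρ ~ μ`, `μ` a joint distribution over pure strategy profiles. -/
def expect {P₁ P₂ : Type*} [Fintype P₁] [Fintype P₂]
    (μ : P₁ × P₂ → ℝ) (f : P₁ × P₂ → ℝ) : ℝ :=
  ∑ ρ, μ ρ * f ρ

/-- `μ` is an ε-coarse correlated equilibrium of the two-player game with utilities
`u₁, u₂`: no player can gain more than `ε` in expectation by deviating to any fixed
mixed strategy while the opponent's pure strategy is drawn from `μ`. -/
def IsCCE {P₁ P₂ : Type*} [Fintype P₁] [Fintype P₂]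
    (ε : ℝ) (u₁ u₂ : P₁ × P₂ → ℝ) (μ : P₁ × P₂ → ℝ) : Prop :=
  (∀ s₁' : P₁ → ℝ, IsDist s₁' → expect μ (fun ρ => mixedU1 u₁ s₁' ρ.2 - u₁ ρ) ≤ ε) ∧
  (∀ s₂' : P₂ → ℝ, IsDist s₂' → expect μ (fun ρ => mixedU2 u₂ ρ.1 s₂' - u₂ ρ) ≤ ε)

/-- The first marginal of a probability distribution is a probability distribution. -/
theorem IsDist.marg1 {P₁ P₂ : Type*} [Fintype P₁] [Fintype P₂] {μ : P₁ × P₂ → ℝ}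
    (hμ : IsDist μ) : IsDist (marg1 μ) :=
  ⟨fun _ => sum_nonneg fun _ _ => hμ.1 _, (Fintype.sum_prod_type μ).symm.trans hμ.2⟩

/-- The second marginal of a probability distribution is a probability distribution. -/
theorem IsDist.marg2 {P₁ P₂ : Type*} [Fintype P₁] [Fintype P₂] {μ : P₁ × P₂ → ℝ}
    (hμ : IsDist μ) : IsDist (marg2 μ) :=
  ⟨fun _ => sum_nonneg fun _ _ => hμ.1 _, (Fintype.sum_prod_type_right μ).symm.trans hμ.2⟩

theorem expect_sub {P₁ P₂ : Type*} [Fintype P₁] [Fintype P₂] (μ f g : P₁ × P₂ → ℝ) :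
    expect μ (fun ρ => f ρ - g ρ) = expect μ f - expect μ g := by
  simp only [_root_.expect, mul_sub, sum_sub_distrib]

/-- Against a fixed mixed strategy of player 1, only the second marginal of `μ` matters. -/
theorem expect_mixedU1 {P₁ P₂ : Type*} [Fintype P₁] [Fintype P₂]
    (μ u : P₁ × P₂ → ℝ) (s : P₁ → ℝ) :
    expect μ (fun ρ => mixedU1 u s ρ.2) = mixedU u s (marg2 μ) := by
  simp only [_root_.expect, mixedU1, mixedU, marg2]
  rw [Fintype.sum_prod_type_right, sum_comm (γ := P₁)]
  refine sum_congr rfl fun b _ => ?_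
  dsimp only
  rw [← Finset.sum_mul, Finset.mul_sum]
  exact sum_congr rfl fun a _ => by ring

/-- Against a fixed mixed strategy of player 2, only the first marginal of `μ` matters. -/
theorem expect_mixedU2 {P₁ P₂ : Type*} [Fintype P₁] [Fintype P₂]
    (μ u : P₁ × P₂ → ℝ) (s : P₂ → ℝ) :
    expect μ (fun ρ => mixedU2 u ρ.1 s) = mixedU u (marg1 μ) s := by
  simp only [_root_.expect, mixedU2, mixedU, marg1]
  rw [Fintype.sum_prod_type]
  refine sum_congr rfl fun a _ => ?_
  dsimp only
  rw [← Finset.sum_mul, Finset.mul_sum]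
  exact sum_congr rfl fun b _ => by ring

/-- in any finite two-player game, if `μ` is an ε-CCE then for each
player the utility of the marginal strategy profile exceeds the expected utility
under `μ` by at most `ε`. -/
theorem marginal_profile_value_le {P₁ P₂ : Type*} [Fintype P₁] [Fintype P₂]
    [Nonempty P₁] [Nonempty P₂]
    (u₁ u₂ : P₁ × P₂ → ℝ)
    (μ : P₁ × P₂ → ℝ) (hμ : IsDist μ)
    (ε : ℝ) (hε : 0 ≤ ε) (hcce : IsCCE ε u₁ u₂ μ) :
    mixedU u₁ (marg1 μ) (marg2 μ) - expect μ u₁ ≤ ε ∧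
    mixedU u₂ (marg1 μ) (marg2 μ) - expect μ u₂ ≤ ε := by
  constructor
  · rw [← expect_mixedU1, ← expect_sub]
    exact hcce.1 _ hμ.marg1
  · rw [← expect_mixedU2, ← expect_sub]
    exact hcce.2 _ hμ.marg2
end

section
/- In a finite two-player zero-sum game, if μ is an ε-coarse correlated equilibrium, then for each player i the expected utility under μ and the utility of the marginal strategy profile differ by at most ε in absolute value; that is, |E_{ρ∼μ}[u_i(ρ)] − u_i(s^μ)| ≤ ε. -/
open Finset

/-- in a finite two-player zero-sum game, if `μ` is an ε-CCE then for
each player the expected utility under `μ` and the utility of the marginal strategy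
profile differ by at most `ε` in absolute value. -/
theorem abs_expect_sub_marginal_le {P₁ P₂ : Type*} [Fintype P₁] [Fintype P₂]
    [Nonempty P₁] [Nonempty P₂]
    (u₁ u₂ : P₁ × P₂ → ℝ) (hzs : ∀ ρ : P₁ × P₂, u₁ ρ + u₂ ρ = 0)
    (μ : P₁ × P₂ → ℝ) (hμ : IsDist μ)
    (ε : ℝ) (hε : 0 ≤ ε) (hcce : IsCCE ε u₁ u₂ μ) :
    |expect μ u₁ - mixedU u₁ (marg1 μ) (marg2 μ)| ≤ ε ∧
    |expect μ u₂ - mixedU u₂ (marg1 μ) (marg2 μ)| ≤ ε := by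
  obtain ⟨h₁, h₂⟩ := hcce
  replace h₁ := h₁ _ hμ.marg1
  replace h₂ := h₂ _ hμ.marg2
  rw [expect_sub, expect_mixedU1] at h₁
  rw [expect_sub, expect_mixedU2] at h₂
  obtain rfl : u₂ = fun ρ => -u₁ ρ := funext fun ρ => eq_neg_of_add_eq_zero_right (hzs ρ)
  have he : expect μ (fun ρ => -u₁ ρ) = -expect μ u₁ := by
    simp only [_root_.expect, mul_neg, Finset.sum_neg_distrib]
  have hm : mixedU (fun ρ => -u₁ ρ) (marg1 μ) (marg2 μ) = -mixedU u₁ (marg1 μ) (marg2 μ) := by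
    simp only [mixedU, mul_neg, Finset.sum_neg_distrib]
  rw [he, hm] at h₂ ⊢
  constructor <;> rw [abs_le] <;> constructor <;> linarith
end

section
/- In a finite two-player zero-sum game, if μ is an ε-coarse correlated equilibrium, then the marginal strategy profile s^μ is a 2ε-Nash equilibrium: for each player i and every mixed strategy s′_i of player i, u_i(s′_i, s^μ_{−i}) − u_i(s^μ) ≤ 2ε. -/
open Finset

theorem expect_mixedU1_sub {P₁ P₂ : Type*} [Fintype P₁] [Fintype P₂]
    (u μ : P₁ × P₂ → ℝ) (s : P₁ → ℝ) :
    expect μ (fun ρ => mixedU1 u s ρ.2 - u ρ) = mixedU u s (marg2 μ) - expect μ u := by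
  simp only [_root_.expect, mixedU, mixedU1, marg2, mul_sub, sum_sub_distrib]
  congr 1
  rw [Fintype.sum_prod_type_right, sum_comm (f := fun a b => s a * _ * u (a, b))]
  refine sum_congr rfl fun b _ => ?_
  simp only [← sum_mul]
  rw [mul_sum]
  exact sum_congr rfl fun a _ => by ring

theorem expect_mixedU2_sub {P₁ P₂ : Type*} [Fintype P₁] [Fintype P₂]
    (u μ : P₁ × P₂ → ℝ) (s : P₂ → ℝ) :
    expect μ (fun ρ => mixedU2 u ρ.1 s - u ρ) = mixedU u (marg1 μ) s - expect μ u := by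
  simp only [_root_.expect, mixedU, mixedU2, marg1, mul_sub, sum_sub_distrib]
  congr 1
  rw [Fintype.sum_prod_type]
  refine sum_congr rfl fun a _ => ?_
  simp only [← sum_mul]
  rw [mul_sum]
  exact sum_congr rfl fun b _ => by ring

theorem expect_neg_utility {P₁ P₂ : Type*} [Fintype P₁] [Fintype P₂] (μ u : P₁ × P₂ → ℝ) :
    expect μ (-u) = -expect μ u := by
  simp [_root_.expect]

theorem mixedU_neg {P₁ P₂ : Type*} [Fintype P₁] [Fintype P₂] (u : P₁ × P₂ → ℝ)
    (s₁ : P₁ → ℝ) (s₂ : P₂ → ℝ) : mixedU (-u) s₁ s₂ = -mixedU u s₁ s₂ := by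
  simp [mixedU]

/-- in a finite two-player zero-sum game, if `μ` is an ε-CCE then the
marginal strategy profile is a 2ε-Nash equilibrium. -/
theorem cce_marginals_twoEps_nash {P₁ P₂ : Type*} [Fintype P₁] [Fintype P₂]
    [Nonempty P₁] [Nonempty P₂]
    (u₁ u₂ : P₁ × P₂ → ℝ) (hzs : ∀ ρ : P₁ × P₂, u₁ ρ + u₂ ρ = 0)
    (μ : P₁ × P₂ → ℝ) (hμ : IsDist μ)
    (ε : ℝ) (hε : 0 ≤ ε) (hcce : IsCCE ε u₁ u₂ μ) :
    (∀ s₁' : P₁ → ℝ, IsDist s₁' →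
      mixedU u₁ s₁' (marg2 μ) - mixedU u₁ (marg1 μ) (marg2 μ) ≤ 2 * ε) ∧
    (∀ s₂' : P₂ → ℝ, IsDist s₂' →
      mixedU u₂ (marg1 μ) s₂' - mixedU u₂ (marg1 μ) (marg2 μ) ≤ 2 * ε) := by
  obtain rfl : u₂ = -u₁ := funext fun ρ => eq_neg_of_add_eq_zero_right (hzs ρ)
  obtain ⟨h₁, h₂⟩ := hcce
  simp only [expect_mixedU1_sub, expect_mixedU2_sub, expect_neg_utility, mixedU_neg] at h₁ h₂ ⊢
  have k₁ := h₁ _ hμ.marg1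
  have k₂ := h₂ _ hμ.marg2
  exact ⟨fun s hs => by linarith [h₁ s hs], fun s hs => by linarith [h₂ s hs]⟩
end
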